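/- Fix w ∈ W, an index 1 ≤ i ≤ r, and v ∈ W^{P_i}. Let u ∈ W^{P_i} be the minimal-length representative of (w⁻¹ * v) W_{P_i} and let y ∈ W_{P_i} be the unique element with w⁻¹ * v = u y⁻¹ and ℓ(u y⁻¹) = ℓ(u) + ℓ(y). Then W_{P_i} ∩ {v⁻¹ q u : q ∈ W, q ≤ w} = {y' ∈ W : y' ≤ y}; in particular, this intersection is the Bruhat interval [e, y] inside W_{P_i}. -/

import Mathlib

open scoped Classical

/-- Data of a root system with a fixed choice of simple roots: an ambient
`ℚ`-vector space `V`, a set of roots `Φ` with a distinguished subset `pos` of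
positive roots, a coroot functional `coroot β = ⟨·, β^∨⟩` for each root, and
simple roots `α 1, …, α r`. -/
structure RootData where
  r : ℕ
  V : Type
  [grp : AddCommGroup V]
  [mod : Module ℚ V]
  Φ : Set V
  pos : Set V
  coroot : V → Module.Dual ℚ V
  α : Fin r → V

attribute [instance] RootData.grp RootData.mod

namespace RootData

variable (R : RootData)

/-- The group of linear automorphisms of `V`, in which the Weyl group lives. -/
abbrev Aut : Type := R.V ≃ₗ[ℚ] R.V

/-- The linear map `v ↦ v - ⟨v, β^∨⟩ β`. -/
noncomputable def reflMap (β : R.V) : R.V →ₗ[ℚ] R.V :=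
  LinearMap.id - (R.coroot β).smulRight β

/-- The reflection `s_β` associated to a root `β`, as a linear automorphism. -/
noncomputable def s (β : R.V) : R.Aut :=
  if h : (R.reflMap β).comp (R.reflMap β) = LinearMap.id then
    LinearEquiv.ofLinear (R.reflMap β) (R.reflMap β) h h
  else LinearEquiv.refl ℚ R.V

/-- The simple reflections `s_i := s_{α_i}`. -/
noncomputable def S (i : Fin R.r) : R.Aut := R.s (R.α i)

/-- The Weyl group `W`, generated by the simple reflections. -/
noncomputable def weylGroup : Subgroup R.Aut := Subgroup.closure (Set.range R.S)

/-- The product `s_{i_1} ⋯ s_{i_k}` of a word in the simple reflections. -/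
noncomputable def wordProd (l : List (Fin R.r)) : R.Aut := (l.map R.S).prod

/-- The length function on `W`: least length of a word in the simple
reflections expressing the given element. -/
noncomputable def len (w : R.Aut) : ℕ :=
  sInf {n | ∃ l : List (Fin R.r), l.length = n ∧ R.wordProd l = w}

/-- A word is reduced if its length equals the length of its product. -/
def Reduced (l : List (Fin R.r)) : Prop := R.len (R.wordProd l) = l.length

/-- The Bruhat order on `W`: `u ≤ w` iff some reduced word for `w` has a
subword whose product is `u`. -/
def BruhatLE (u w : R.Aut) : Prop :=
  ∃ l : List (Fin R.r), R.Reduced l ∧ R.wordProd l = w ∧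
    ∃ l' : List (Fin R.r), l'.Sublist l ∧ R.wordProd l' = u

/-- Strict Bruhat order. -/
def BruhatLT (u w : R.Aut) : Prop := R.BruhatLE u w ∧ u ≠ w

/-- One step of the Demazure product: `s_i * w := max {w, s_i w}`. -/
noncomputable def dmulStep (i : Fin R.r) (x : R.Aut) : R.Aut :=
  if R.len x < R.len (R.S i * x) then R.S i * x else x

/-- Demazure product of a word in the simple reflections against `w`:
`s_{i_1} * (s_{i_2} * (⋯ * (s_{i_k} * w)))`. -/
noncomputable def dmulList (l : List (Fin R.r)) (w : R.Aut) : R.Aut :=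
  l.foldr R.dmulStep w

/-- The Demazure product `v * w` on the Weyl group, computed by choosing a
reduced word for `v` (it is independent of this choice). -/
noncomputable def dmul (v w : R.Aut) : R.Aut :=
  if h : ∃ l : List (Fin R.r), R.Reduced l ∧ R.wordProd l = v then
    R.dmulList h.choose w
  else v * w

/-- The parabolic subgroup `W_{P_i}` generated by the simple reflections
`s_j`, `j ≠ i`. -/
noncomputable def WPar (i : Fin R.r) : Subgroup R.Aut :=
  Subgroup.closure (R.S '' {j | j ≠ i})

/-- `W^{P_i}`: the set of minimal-length representatives of cosets of
`W/W_{P_i}`. -/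
def minReps (i : Fin R.r) : Set R.Aut :=
  {v | v ∈ R.weylGroup ∧ ∀ p ∈ R.WPar i, R.len v ≤ R.len (v * p)}

/-- `u` is the minimal-length representative of the coset `w W_{P_i}`. -/
def IsMinRep (i : Fin R.r) (u w : R.Aut) : Prop :=
  u ∈ R.minReps i ∧ u⁻¹ * w ∈ R.WPar i

/-- A weight is dominant if it pairs nonnegatively with every simple coroot. -/
def Dominant (lam : R.V) : Prop := ∀ i : Fin R.r, 0 ≤ R.coroot (R.α i) lam

/-- The dual action of the Weyl group on `V* `: `(u f)(v) = f(u⁻¹ v)`. -/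
noncomputable def dualAct (u : R.Aut) (f : Module.Dual ℚ R.V) : Module.Dual ℚ R.V :=
  f.comp (u.symm : R.V →ₗ[ℚ] R.V)

/-- The Demazure polytope `P_λ^w := conv {uλ : u ∈ W, u ≤ w}`. -/
noncomputable def demPolytope (lam : R.V) (w : R.Aut) : Set R.V :=
  convexHull ℚ {m | ∃ u : R.Aut, u ∈ R.weylGroup ∧ R.BruhatLE u w ∧ m = u lam}

/-- Membership in the weight lattice `X`. -/
def IsWeight (lam : R.V) : Prop := ∀ β ∈ R.Φ, ∃ m : ℤ, R.coroot β lam = (m : ℚ)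

/-- The root lattice `Q = ℤΦ`. -/
noncomputable def rootLattice : AddSubgroup R.V := AddSubgroup.closure R.Φ

/-- `w₀` is the longest element of the Weyl group. -/
def IsLongest (w₀ : R.Aut) : Prop :=
  w₀ ∈ R.weylGroup ∧ ∀ g ∈ R.weylGroup, R.len g ≤ R.len w₀

/-- The positive roots `Φ_{P_i}⁺ = Φ⁺ ∩ span {α_j : j ≠ i}` of the standard
Levi subsystem. -/
def parPos (i : Fin R.r) : Set R.V :=
  {η | η ∈ R.pos ∧ η ∈ Submodule.span ℚ (R.α '' {j | j ≠ i})}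

/-- The value `D_i (e^λ)` of the Demazure operator on a basis element of the
group ring `ℤ[X]`. -/
noncomputable def demOnBasis (i : Fin R.r) (lam : R.V) : R.V →₀ ℤ :=
  if 0 ≤ ⌊R.coroot (R.α i) lam⌋ then
    ∑ k ∈ Finset.range (⌊R.coroot (R.α i) lam⌋.toNat + 1),
      Finsupp.single (lam - (k : ℚ) • R.α i) 1
  else if ⌊R.coroot (R.α i) lam⌋ = -1 then 0
  else - ∑ k ∈ Finset.range ((-⌊R.coroot (R.α i) lam⌋).toNat - 1),
      Finsupp.single (lam + ((k : ℚ) + 1) • R.α i) 1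

/-- The Demazure operator `D_i`, as a `ℤ`-linear endomorphism of the group
ring `ℤ[X]` (realized as finitely supported functions `V →₀ ℤ`). -/
noncomputable def demOp (i : Fin R.r) : (R.V →₀ ℤ) →ₗ[ℤ] (R.V →₀ ℤ) :=
  Finsupp.lsum ℤ fun lam => LinearMap.toSpanSingleton ℤ (R.V →₀ ℤ) (R.demOnBasis i lam)

/-- The Demazure character `D_{i_1} ⋯ D_{i_k} (e^λ)`. -/
noncomputable def demChar (l : List (Fin R.r)) (lam : R.V) : R.V →₀ ℤ :=
  l.foldr (fun i p => R.demOp i p) (Finsupp.single lam 1)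

/-- The axioms of a finite crystallographic root system spanning `V`, with
simple roots `α_i` and positive roots `pos`. -/
structure IsRootSystem (R : RootData) : Prop where
  finite : R.Φ.Finite
  span_top : Submodule.span ℚ R.Φ = ⊤
  ne_zero : ∀ β ∈ R.Φ, β ≠ 0
  coroot_self : ∀ β ∈ R.Φ, R.coroot β β = 2
  crystallographic : ∀ β ∈ R.Φ, ∀ γ ∈ R.Φ, ∃ m : ℤ, R.coroot β γ = (m : ℚ)
  reflection_stable : ∀ β ∈ R.Φ, ∀ γ ∈ R.Φ, γ - R.coroot β γ • β ∈ R.Φ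
  simple_mem : ∀ i, R.α i ∈ R.Φ
  indep : LinearIndependent ℚ R.α
  pos_subset : R.pos ⊆ R.Φ
  pos_or_neg : ∀ β ∈ R.Φ, (β ∈ R.pos ∧ -β ∉ R.pos) ∨ (β ∉ R.pos ∧ -β ∈ R.pos)
  simple_pos : ∀ i, R.α i ∈ R.pos
  pos_nonneg_comb : ∀ β ∈ R.pos, ∃ c : Fin R.r → ℚ, (∀ i, 0 ≤ c i) ∧ β = ∑ i, c i • R.α i

end RootData

namespace RootData

variable {R : RootData}

namespace IsRootSystem

/-! ### Reflections and roots -/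

lemma s_apply {β : R.V} (hR : R.IsRootSystem) (hβ : β ∈ R.Φ) (x : R.V) :
    R.s β x = x - R.coroot β x • β := by
  have h : (R.reflMap β).comp (R.reflMap β) = LinearMap.id := by
    ext x
    simp only [reflMap, LinearMap.comp_apply, LinearMap.sub_apply, LinearMap.id_apply,
      LinearMap.smulRight_apply, map_sub, map_smul, hR.coroot_self β hβ]
    module
  rw [s, dif_pos h]
  simp [reflMap]

lemma s_mul_self {β : R.V} (hR : R.IsRootSystem) (hβ : β ∈ R.Φ) : R.s β * R.s β = 1 := by
  ext x
  simp only [LinearEquiv.mul_apply, hR.s_apply hβ, map_sub, map_smul, hR.coroot_self β hβ,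
    smul_eq_mul, LinearEquiv.coe_one, id_eq]
  module

lemma s_inv {β : R.V} (hR : R.IsRootSystem) (hβ : β ∈ R.Φ) : (R.s β)⁻¹ = R.s β :=
  inv_eq_of_mul_eq_one_left (hR.s_mul_self hβ)

lemma s_apply_self {β : R.V} (hR : R.IsRootSystem) (hβ : β ∈ R.Φ) : R.s β β = -β := by
  rw [hR.s_apply hβ, hR.coroot_self β hβ]
  module

lemma S_mul_self (hR : R.IsRootSystem) (i : Fin R.r) : R.S i * R.S i = 1 :=
  hR.s_mul_self (hR.simple_mem i)

lemma S_inv (hR : R.IsRootSystem) (i : Fin R.r) : (R.S i)⁻¹ = R.S i :=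
  hR.s_inv (hR.simple_mem i)

lemma S_mul_S_mul (hR : R.IsRootSystem) (i : Fin R.r) (x : R.Aut) :
    R.S i * (R.S i * x) = x := by
  rw [← mul_assoc, hR.S_mul_self, one_mul]

lemma S_mem (i : Fin R.r) : R.S i ∈ R.weylGroup :=
  Subgroup.subset_closure ⟨i, rfl⟩

lemma apply_mem_roots (hR : R.IsRootSystem) {x : R.Aut} (hx : x ∈ R.weylGroup) {β : R.V}
    (hβ : β ∈ R.Φ) : x β ∈ R.Φ := by
  induction hx using Subgroup.closure_induction_left with
  | one => simpa using hβ
  | mul_left s hs y hy ih =>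
    obtain ⟨i, rfl⟩ := hs
    rw [LinearEquiv.mul_apply, S, hR.s_apply (hR.simple_mem i)]
    exact hR.reflection_stable _ (hR.simple_mem i) _ ih
  | inv_mul_cancel s hs y hy ih =>
    obtain ⟨i, rfl⟩ := hs
    rw [hR.S_inv, LinearEquiv.mul_apply, S, hR.s_apply (hR.simple_mem i)]
    exact hR.reflection_stable _ (hR.simple_mem i) _ ih

lemma neg_mem_pos (hR : R.IsRootSystem) {β : R.V} (hβ : β ∈ R.Φ) : -β ∈ R.pos ↔ β ∉ R.pos := by
  have := hR.pos_or_neg β hβ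
  tauto

/-- A reflection preserving the finite spanning set of roots is determined by its root line. -/
lemma s_eq_conj (hR : R.IsRootSystem) {g : R.Aut} (hg : g ∈ R.weylGroup) {β γ : R.V}
    (hβ : β ∈ R.Φ) (hγ : γ ∈ R.Φ) {c : ℚ} (h : g β = c • γ) : R.s γ = g * R.s β * g⁻¹ := by
  have hc : c ≠ 0 := by
    rintro rfl
    rw [zero_smul] at h
    exact hR.ne_zero _ (hR.apply_mem_roots hg hβ) h
  have hγβ : g⁻¹ γ = c⁻¹ • β := by
    have : γ = g (c⁻¹ • β) := by rw [map_smul, h, inv_smul_smul₀ hc]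
    rw [this, ← LinearEquiv.mul_apply, inv_mul_cancel, LinearEquiv.coe_one, id_eq]
  have hconj : ∀ x, (g * R.s β * g⁻¹) x = x - (c * R.coroot β (g⁻¹ x)) • γ := by
    intro x
    rw [LinearEquiv.mul_apply, LinearEquiv.mul_apply, hR.s_apply hβ, map_sub, map_smul, h,
      ← LinearEquiv.mul_apply g, mul_inv_cancel, LinearEquiv.coe_one, id_eq, smul_smul, mul_comm c]
  have key : R.coroot γ = c • (R.coroot β).comp (g⁻¹ : R.Aut).toLinearMap := by
    refine Module.Dual.eq_of_preReflection_mapsTo (x := γ) hR.finite hR.span_top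
      (hR.coroot_self γ hγ) ?_ ?_ ?_
    · intro x hx
      rw [Module.preReflection_apply]
      exact hR.reflection_stable γ hγ x hx
    · change c * R.coroot β (g⁻¹ γ) = 2
      rw [hγβ, map_smul, hR.coroot_self β hβ, smul_eq_mul]
      field_simp
    · intro x hx
      have hmem : (g * R.s β * g⁻¹) x ∈ R.Φ := by
        rw [LinearEquiv.mul_apply, LinearEquiv.mul_apply, hR.s_apply hβ]
        exact hR.apply_mem_roots hg
          (hR.reflection_stable β hβ _ (hR.apply_mem_roots (inv_mem hg) hx))
      rw [hconj] at hmem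
      rw [Module.preReflection_apply]
      exact hmem
  ext x
  rw [hconj, hR.s_apply hγ, key]
  rfl

lemma s_apply_eq_conj (hR : R.IsRootSystem) {g : R.Aut} (hg : g ∈ R.weylGroup) {β : R.V}
    (hβ : β ∈ R.Φ) : R.s (g β) = g * R.s β * g⁻¹ :=
  hR.s_eq_conj hg hβ (hR.apply_mem_roots hg hβ) (one_smul ℚ _).symm

lemma s_eq_of_smul (hR : R.IsRootSystem) {β γ : R.V} (hβ : β ∈ R.Φ) (hγ : γ ∈ R.Φ) {c : ℚ}
    (h : β = c • γ) : R.s β = R.s γ := by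
  have := hR.s_eq_conj (g := 1) (one_mem _) hβ hγ (c := c) (by simpa using h)
  simpa using this.symm

lemma S_apply_mem_pos_or (hR : R.IsRootSystem) (i : Fin R.r) {β : R.V} (hβ : β ∈ R.pos) :
    R.S i β ∈ R.pos ∨ ∃ c : ℚ, β = c • R.α i := by
  by_contra! hcon
  obtain ⟨h1, h2⟩ := hcon
  rw [← hR.neg_mem_pos (hR.apply_mem_roots (S_mem i) (hR.pos_subset hβ))] at h1
  obtain ⟨c, hc, hβc⟩ := hR.pos_nonneg_comb _ hβ
  obtain ⟨d, hd, hβd⟩ := hR.pos_nonneg_comb _ h1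
  have hsum : ∑ j, (c j + d j - if j = i then R.coroot (R.α i) β else 0) • R.α j = 0 := by
    simp only [sub_smul, add_smul, Finset.sum_sub_distrib, Finset.sum_add_distrib, ite_smul,
      zero_smul, Finset.sum_ite_eq', Finset.mem_univ, if_true]
    rw [← hβc, ← hβd, S, hR.s_apply (hR.simple_mem i)]
    abel
  have hz := Fintype.linearIndependent_iff.1 hR.indep _ hsum
  refine h2 (c i) ?_
  conv_lhs => rw [hβc]
  refine Finset.sum_eq_single i (fun j _ hj => ?_) (by simp)
  have := hz j
  rw [if_neg hj] at this
  have h0 : c j = 0 := by linarith [hc j, hd j]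
  rw [h0, zero_smul]

/-! ### Words and length -/

lemma wordProd_cons (i : Fin R.r) (l : List (Fin R.r)) :
    R.wordProd (i :: l) = R.S i * R.wordProd l := by simp [wordProd]

lemma wordProd_nil : R.wordProd [] = 1 := rfl

lemma wordProd_mem (l : List (Fin R.r)) : R.wordProd l ∈ R.weylGroup := by
  induction l with
  | nil => exact one_mem _
  | cons i l ih => rw [wordProd_cons]; exact mul_mem (S_mem i) ih

lemma exists_word_of_mem_closure (hR : R.IsRootSystem) {J : Set (Fin R.r)} {x : R.Aut}
    (hx : x ∈ Subgroup.closure (R.S '' J)) :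
    ∃ l : List (Fin R.r), (∀ j ∈ l, j ∈ J) ∧ R.wordProd l = x := by
  induction hx using Subgroup.closure_induction_left with
  | one => exact ⟨[], by simp, rfl⟩
  | mul_left s hs y hy ih =>
    obtain ⟨j, hj, rfl⟩ := hs
    obtain ⟨l, hl, rfl⟩ := ih
    exact ⟨j :: l, by simpa using ⟨hj, hl⟩, wordProd_cons j l⟩
  | inv_mul_cancel s hs y hy ih =>
    obtain ⟨j, hj, rfl⟩ := hs
    obtain ⟨l, hl, rfl⟩ := ih
    exact ⟨j :: l, by simpa using ⟨hj, hl⟩, by rw [wordProd_cons, hR.S_inv]⟩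

lemma exists_word (hR : R.IsRootSystem) {x : R.Aut} (hx : x ∈ R.weylGroup) :
    ∃ l : List (Fin R.r), R.wordProd l = x := by
  rw [weylGroup, ← Set.image_univ] at hx
  obtain ⟨l, -, hl⟩ := hR.exists_word_of_mem_closure hx
  exact ⟨l, hl⟩

lemma len_wordProd_le (l : List (Fin R.r)) : R.len (R.wordProd l) ≤ l.length :=
  Nat.sInf_le ⟨l, rfl, rfl⟩

lemma exists_reduced_word (hR : R.IsRootSystem) {x : R.Aut} (hx : x ∈ R.weylGroup) :
    ∃ l : List (Fin R.r), R.Reduced l ∧ R.wordProd l = x := by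
  obtain ⟨l, hl⟩ := hR.exists_word hx
  obtain ⟨m, hm, rfl⟩ := Nat.sInf_mem
    (s := {n | ∃ l : List (Fin R.r), l.length = n ∧ R.wordProd l = x}) ⟨_, l, rfl, hl⟩
  exact ⟨m, hm.symm, rfl⟩

lemma len_mul_le (hR : R.IsRootSystem) {x y : R.Aut} (hx : x ∈ R.weylGroup)
    (hy : y ∈ R.weylGroup) : R.len (x * y) ≤ R.len x + R.len y := by
  obtain ⟨l, hl, rfl⟩ := hR.exists_reduced_word hx
  obtain ⟨m, hm, rfl⟩ := hR.exists_reduced_word hy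
  rw [hl, hm, ← List.length_append]
  refine le_trans (le_of_eq ?_) (len_wordProd_le (l ++ m))
  simp [wordProd]

lemma len_S_le (i : Fin R.r) : R.len (R.S i) ≤ 1 := by
  simpa [wordProd] using len_wordProd_le (R := R) [i]

lemma len_inv_le (hR : R.IsRootSystem) {x : R.Aut} (hx : x ∈ R.weylGroup) :
    R.len x⁻¹ ≤ R.len x := by
  obtain ⟨l, hl, rfl⟩ := hR.exists_reduced_word hx
  have h : (R.wordProd l)⁻¹ = R.wordProd l.reverse := by
    simp only [wordProd, List.prod_inv_reverse, List.map_map, List.map_reverse]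
    congr 3
    funext i
    exact hR.S_inv i
  rw [hl, h, ← List.length_reverse]
  exact len_wordProd_le _

lemma len_inv (hR : R.IsRootSystem) {x : R.Aut} (hx : x ∈ R.weylGroup) :
    R.len x⁻¹ = R.len x :=
  le_antisymm (hR.len_inv_le hx) (by simpa using hR.len_inv_le (inv_mem hx))

lemma len_one : R.len (1 : R.Aut) = 0 :=
  Nat.le_zero.1 (len_wordProd_le (R := R) [])

lemma eq_one_of_len_eq_zero (hR : R.IsRootSystem) {x : R.Aut} (hx : x ∈ R.weylGroup)
    (h : R.len x = 0) : x = 1 := by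
  obtain ⟨l, hl, rfl⟩ := hR.exists_reduced_word hx
  rw [List.length_eq_zero_iff.1 (hl.symm.trans h), wordProd_nil]

/-- The strong exchange property, for words that need not be reduced. -/
lemma exists_eraseIdx (hR : R.IsRootSystem) (l : List (Fin R.r)) {β : R.V} (hβ : β ∈ R.pos)
    (h : (R.wordProd l)⁻¹ β ∉ R.pos) :
    ∃ k < l.length, R.s β * R.wordProd l = R.wordProd (l.eraseIdx k) := by
  induction l generalizing β with
  | nil => exact absurd (by simpa [wordProd_nil] using hβ) h
  | cons i l ih =>
    have hβΦ := hR.pos_subset hβ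
    rcases hR.S_apply_mem_pos_or i hβ with hpos | ⟨c, hc⟩
    · have h' : (R.wordProd l)⁻¹ (R.S i β) ∉ R.pos := by
        rwa [wordProd_cons, mul_inv_rev, hR.S_inv] at h
      obtain ⟨k, hk, hkl⟩ := ih hpos h'
      refine ⟨k + 1, by simpa using hk, ?_⟩
      rw [List.eraseIdx_cons_succ, wordProd_cons, wordProd_cons, ← hkl,
        hR.s_apply_eq_conj (S_mem i) hβΦ, hR.S_inv]
      simp only [mul_assoc, hR.S_mul_S_mul]
    · refine ⟨0, by simp, ?_⟩
      rw [List.eraseIdx_cons_zero, wordProd_cons, hR.s_eq_of_smul hβΦ (hR.simple_mem i) hc]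
      exact hR.S_mul_S_mul i _

lemma len_s_mul_lt (hR : R.IsRootSystem) {x : R.Aut} (hx : x ∈ R.weylGroup) {β : R.V}
    (hβ : β ∈ R.pos) (h : x⁻¹ β ∉ R.pos) : R.len (R.s β * x) < R.len x := by
  obtain ⟨l, hl, rfl⟩ := hR.exists_reduced_word hx
  obtain ⟨k, hk, hkl⟩ := hR.exists_eraseIdx l hβ h
  rw [hkl, hl]
  refine (len_wordProd_le _).trans_lt ?_
  rw [List.length_eraseIdx_of_lt hk]
  omega

lemma len_S_mul_of_notMem (hR : R.IsRootSystem) {x : R.Aut} (hx : x ∈ R.weylGroup)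
    {i : Fin R.r} (h : x⁻¹ (R.α i) ∉ R.pos) : R.len x = R.len (R.S i * x) + 1 := by
  have h1 := hR.len_s_mul_lt hx (hR.simple_pos i) h
  have h2 := hR.len_mul_le (S_mem i) (mul_mem (S_mem i) hx)
  rw [hR.S_mul_S_mul] at h2
  have h3 := len_S_le (R := R) i
  change R.len (R.S i * x) < R.len x at h1
  omega

lemma len_S_mul_of_mem (hR : R.IsRootSystem) {x : R.Aut} (hx : x ∈ R.weylGroup)
    {i : Fin R.r} (h : x⁻¹ (R.α i) ∈ R.pos) : R.len (R.S i * x) = R.len x + 1 := by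
  have h1 : (R.S i * x)⁻¹ (R.α i) ∉ R.pos := by
    have hΦ := hR.apply_mem_roots (inv_mem hx) (hR.simple_mem i)
    rw [mul_inv_rev, hR.S_inv, LinearEquiv.mul_apply, S, hR.s_apply_self (hR.simple_mem i),
      map_neg, hR.neg_mem_pos hΦ]
    exact fun h' => h' h
  have := hR.len_S_mul_of_notMem (mul_mem (S_mem i) hx) h1
  rwa [hR.S_mul_S_mul] at this

lemma len_lt_len_S_mul_iff (hR : R.IsRootSystem) {x : R.Aut} (hx : x ∈ R.weylGroup)
    {i : Fin R.r} : R.len x < R.len (R.S i * x) ↔ x⁻¹ (R.α i) ∈ R.pos := by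
  by_cases h : x⁻¹ (R.α i) ∈ R.pos
  · exact iff_of_true (by rw [hR.len_S_mul_of_mem hx h]; omega) h
  · have := hR.len_S_mul_of_notMem hx h
    simp only [h, iff_false]
    omega

lemma len_mul_S (hR : R.IsRootSystem) {x : R.Aut} (hx : x ∈ R.weylGroup) (i : Fin R.r) :
    R.len (x * R.S i) = R.len (R.S i * x⁻¹) := by
  rw [← hR.len_inv (mul_mem hx (S_mem i)), mul_inv_rev, hR.S_inv]

lemma len_mul_S_of_mem (hR : R.IsRootSystem) {x : R.Aut} (hx : x ∈ R.weylGroup)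
    {i : Fin R.r} (h : x (R.α i) ∈ R.pos) : R.len (x * R.S i) = R.len x + 1 := by
  rw [hR.len_mul_S hx, hR.len_S_mul_of_mem (inv_mem hx) (by rwa [inv_inv]), hR.len_inv hx]

lemma len_mul_S_of_notMem (hR : R.IsRootSystem) {x : R.Aut} (hx : x ∈ R.weylGroup)
    {i : Fin R.r} (h : x (R.α i) ∉ R.pos) : R.len x = R.len (x * R.S i) + 1 := by
  rw [hR.len_mul_S hx, ← hR.len_S_mul_of_notMem (inv_mem hx) (by rwa [inv_inv]), hR.len_inv hx]

end IsRootSystem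

/-! ### The Bruhat order via chains of reflections -/

/-- `x` is obtained from `u ∈ W` by left multiplication with a length-increasing reflection. -/
def ReflStep (R : RootData) (u x : R.Aut) : Prop :=
  u ∈ R.weylGroup ∧ ∃ β ∈ R.pos, u⁻¹ β ∈ R.pos ∧ x = R.s β * u

/-- The Bruhat order, as the reflexive transitive closure of `ReflStep`. -/
def ChainLE (R : RootData) : R.Aut → R.Aut → Prop := Relation.ReflTransGen R.ReflStep

namespace IsRootSystem

lemma chainLE_S_mul (hR : R.IsRootSystem) {x : R.Aut} (hx : x ∈ R.weylGroup) {i : Fin R.r}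
    (h : R.len x < R.len (R.S i * x)) : R.ChainLE x (R.S i * x) :=
  .single ⟨hx, R.α i, hR.simple_pos i, (hR.len_lt_len_S_mul_iff hx).1 h, rfl⟩

lemma exists_sublist_of_chainLE (hR : R.IsRootSystem) {u x : R.Aut} (h : R.ChainLE u x)
    (l : List (Fin R.r)) (hl : R.wordProd l = x) :
    ∃ m : List (Fin R.r), m.Sublist l ∧ R.wordProd m = u := by
  induction h generalizing l with
  | refl => exact ⟨l, .refl l, hl⟩
  | @tail b c _ hstep ih =>
    obtain ⟨hb, β, hβ, hbβ, rfl⟩ := hstep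
    have hβΦ := hR.pos_subset hβ
    have hneg : (R.wordProd l)⁻¹ β ∉ R.pos := by
      rw [hl, mul_inv_rev, hR.s_inv hβΦ, LinearEquiv.mul_apply, hR.s_apply_self hβΦ, map_neg,
        hR.neg_mem_pos (hR.apply_mem_roots (inv_mem hb) hβΦ)]
      exact fun h' => h' hbβ
    obtain ⟨k, -, hkl⟩ := hR.exists_eraseIdx l hβ hneg
    obtain ⟨m, hm, hmu⟩ := ih (l.eraseIdx k) (by
      rw [← hkl, hl, ← mul_assoc, hR.s_mul_self hβΦ, one_mul])
    exact ⟨m, hm.trans (List.eraseIdx_sublist l k), hmu⟩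

lemma reflStep_S_mul (hR : R.IsRootSystem) (i : Fin R.r) {u x : R.Aut} (h : R.ReflStep u x) :
    R.ReflStep (R.S i * u) (R.S i * x) ∨ R.S i * u = x := by
  obtain ⟨hu, β, hβ, huβ, rfl⟩ := h
  have hβΦ := hR.pos_subset hβ
  rcases hR.S_apply_mem_pos_or i hβ with hpos | ⟨c, hc⟩
  · refine .inl ⟨mul_mem (S_mem i) hu, R.S i β, hpos, ?_, ?_⟩
    · rw [mul_inv_rev, LinearEquiv.mul_apply, ← LinearEquiv.mul_apply (R.S i)⁻¹, inv_mul_cancel]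
      exact huβ
    · rw [hR.s_apply_eq_conj (S_mem i) hβΦ]
      group
  · right
    rw [hR.s_eq_of_smul hβΦ (hR.simple_mem i) hc, S]

lemma chainLE_S_mul_or (hR : R.IsRootSystem) (i : Fin R.r) {u x : R.Aut} (h : R.ChainLE u x) :
    R.ChainLE (R.S i * u) (R.S i * x) ∨ R.ChainLE (R.S i * u) x := by
  induction h with
  | refl => exact .inl .refl
  | tail _ hstep ih =>
    rcases ih with ih | ih
    · rcases hR.reflStep_S_mul i hstep with h | h
      · exact .inl (ih.tail h)
      · exact .inr (h ▸ ih)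
    · exact .inr (ih.tail hstep)

lemma chainLE_S_mul_S_mul (hR : R.IsRootSystem) {i : Fin R.r} {u x : R.Aut}
    (hx : x ∈ R.weylGroup) (h : R.ChainLE u x) (hlt : R.len x < R.len (R.S i * x)) :
    R.ChainLE (R.S i * u) (R.S i * x) :=
  (hR.chainLE_S_mul_or i h).elim id fun h' => h'.trans (hR.chainLE_S_mul hx hlt)

lemma chainLE_S_mul_left (hR : R.IsRootSystem) {i : Fin R.r} {u x : R.Aut}
    (hx : x ∈ R.weylGroup) (h : R.ChainLE u x) (hlt : ¬ R.len x < R.len (R.S i * x)) :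
    R.ChainLE (R.S i * u) x := by
  refine (hR.chainLE_S_mul_or i h).elim (fun h' => h'.trans ?_) id
  rw [hR.len_lt_len_S_mul_iff hx] at hlt
  have hlen := hR.len_S_mul_of_notMem hx hlt
  have := hR.chainLE_S_mul (i := i) (mul_mem (S_mem i) hx) (by rw [hR.S_mul_S_mul]; omega)
  rwa [hR.S_mul_S_mul] at this

lemma chainLE_inv (hR : R.IsRootSystem) {u x : R.Aut} (h : R.ChainLE u x) :
    R.ChainLE u⁻¹ x⁻¹ := by
  induction h with
  | refl => exact .refl
  | @tail b c _ hstep ih =>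
    obtain ⟨hb, β, hβ, hbβ, rfl⟩ := hstep
    have hβΦ := hR.pos_subset hβ
    refine ih.tail ⟨inv_mem hb, b⁻¹ β, hbβ, ?_, ?_⟩
    · rwa [← LinearEquiv.mul_apply, inv_inv, mul_inv_cancel, LinearEquiv.coe_one, id_eq]
    · rw [hR.s_apply_eq_conj (inv_mem hb) hβΦ, mul_inv_rev, hR.s_inv hβΦ]
      group

lemma len_lt_of_reduced_cons (hR : R.IsRootSystem) {i : Fin R.r} {l : List (Fin R.r)}
    (h : R.Reduced (i :: l)) :
    R.Reduced l ∧ R.len (R.wordProd l) < R.len (R.S i * R.wordProd l) := by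
  have h1 := len_wordProd_le l
  have h2 := hR.len_mul_le (S_mem i) (wordProd_mem l)
  have h3 := len_S_le (R := R) i
  rw [Reduced, wordProd_cons, List.length_cons] at h
  rw [Reduced]
  omega

lemma chainLE_of_sublist (hR : R.IsRootSystem) {l m : List (Fin R.r)} (hl : R.Reduced l)
    (hm : m.Sublist l) : R.ChainLE (R.wordProd m) (R.wordProd l) := by
  induction hm with
  | slnil => exact .refl
  | cons i _ ih =>
    obtain ⟨hl', hlt⟩ := hR.len_lt_of_reduced_cons hl
    rw [wordProd_cons i]
    exact (ih hl').trans (hR.chainLE_S_mul (wordProd_mem _) hlt)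
  | cons_cons i _ ih =>
    obtain ⟨hl', hlt⟩ := hR.len_lt_of_reduced_cons hl
    rw [wordProd_cons i, wordProd_cons i]
    exact hR.chainLE_S_mul_S_mul (wordProd_mem _) (ih hl') hlt

lemma bruhatLE_iff_chainLE (hR : R.IsRootSystem) {u x : R.Aut} (hx : x ∈ R.weylGroup) :
    R.BruhatLE u x ↔ R.ChainLE u x := by
  constructor
  · rintro ⟨l, hl, rfl, m, hm, rfl⟩
    exact hR.chainLE_of_sublist hl hm
  · intro h
    obtain ⟨l, hl, rfl⟩ := hR.exists_reduced_word hx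
    exact ⟨l, hl, rfl, hR.exists_sublist_of_chainLE h l rfl⟩

lemma chainLE_or_of_chainLE_S_mul (hR : R.IsRootSystem) {i : Fin R.r} {u x : R.Aut}
    (hx : x ∈ R.weylGroup) (hlt : R.len x < R.len (R.S i * x)) (h : R.ChainLE u (R.S i * x)) :
    R.ChainLE u x ∨ R.ChainLE (R.S i * u) x := by
  obtain ⟨l, hl, rfl⟩ := hR.exists_reduced_word hx
  obtain ⟨m, hm, rfl⟩ := hR.exists_sublist_of_chainLE h (i :: l) (wordProd_cons i l)
  rcases List.sublist_cons_iff.1 hm with hm | ⟨m, rfl, hm'⟩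
  · exact .inl (hR.chainLE_of_sublist hl hm)
  · right
    rw [wordProd_cons, hR.S_mul_S_mul]
    exact hR.chainLE_of_sublist hl hm'

lemma chainLE_of_chainLE_S_mul_S_mul (hR : R.IsRootSystem) {i : Fin R.r} {u x : R.Aut}
    (hu : u ∈ R.weylGroup) (hx : x ∈ R.weylGroup) (hult : R.len u < R.len (R.S i * u))
    (hlt : R.len x < R.len (R.S i * x)) (h : R.ChainLE (R.S i * u) (R.S i * x)) :
    R.ChainLE u x := by
  rcases hR.chainLE_or_of_chainLE_S_mul hx hlt h with h' | h'
  · exact (hR.chainLE_S_mul hu hult).trans h'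
  · rwa [hR.S_mul_S_mul] at h'

/-- Length-additive left factors can be cancelled in the Bruhat order. -/
lemma chainLE_of_chainLE_mul (hR : R.IsRootSystem) {u x z : R.Aut} (hu : u ∈ R.weylGroup)
    (hx : x ∈ R.weylGroup) (hz : z ∈ R.weylGroup) (hux : R.len (u * x) = R.len u + R.len x)
    (huz : R.len (u * z) = R.len u + R.len z) (h : R.ChainLE (u * x) (u * z)) :
    R.ChainLE x z := by
  obtain ⟨l, hl, rfl⟩ := hR.exists_reduced_word hu
  induction l with
  | nil => simpa [wordProd_nil] using h
  | cons i l ih =>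
    have hl' := (hR.len_lt_of_reduced_cons hl).1
    have hS := len_S_le (R := R) i
    have hle : ∀ y ∈ R.weylGroup,
        R.len (R.wordProd (i :: l) * y) = R.len (R.wordProd (i :: l)) + R.len y →
        R.len (R.wordProd l * y) = R.len (R.wordProd l) + R.len y ∧
          R.len (R.wordProd l * y) < R.len (R.S i * (R.wordProd l * y)) := by
      intro y hy hadd
      have h1 := hR.len_mul_le (wordProd_mem l) hy
      have h2 := hR.len_mul_le (S_mem i) (mul_mem (wordProd_mem l) hy)
      rw [hl, wordProd_cons, List.length_cons, mul_assoc] at hadd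
      rw [hl'] at h1 ⊢
      omega
    obtain ⟨hx1, hx2⟩ := hle x hx hux
    obtain ⟨hz1, hz2⟩ := hle z hz huz
    rw [wordProd_cons, mul_assoc, mul_assoc] at h
    exact ih hl' (wordProd_mem l) hx1 hz1 (hR.chainLE_of_chainLE_S_mul_S_mul
      (mul_mem (wordProd_mem l) hx) (mul_mem (wordProd_mem l) hz) hx2 hz2 h)

/-! ### Minimal coset representatives -/

lemma WPar_le (i : Fin R.r) : R.WPar i ≤ R.weylGroup :=
  Subgroup.closure_mono (Set.image_subset_range _ _)

lemma S_mem_WPar {i j : Fin R.r} (hj : j ≠ i) : R.S j ∈ R.WPar i :=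
  Subgroup.subset_closure ⟨j, hj, rfl⟩

lemma wordProd_mem_WPar {i : Fin R.r} {l : List (Fin R.r)} (hl : ∀ j ∈ l, j ≠ i) :
    R.wordProd l ∈ R.WPar i := by
  induction l with
  | nil => exact one_mem _
  | cons j l ih =>
    rw [List.forall_mem_cons] at hl
    rw [wordProd_cons]
    exact mul_mem (S_mem_WPar hl.1) (ih hl.2)

lemma mem_WPar_of_chainLE (hR : R.IsRootSystem) {i : Fin R.r} {g y : R.Aut} (hy : y ∈ R.WPar i)
    (h : R.ChainLE g y) : g ∈ R.WPar i := by
  obtain ⟨l, hl, rfl⟩ := hR.exists_word_of_mem_closure hy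
  obtain ⟨m, hm, rfl⟩ := hR.exists_sublist_of_chainLE h l rfl
  exact wordProd_mem_WPar fun j hj => hl j (hm.subset hj)

lemma apply_mem_span (hR : R.IsRootSystem) {i : Fin R.r} {p : R.Aut} (hp : p ∈ R.WPar i)
    {x : R.V} (hx : x ∈ Submodule.span ℚ (R.α '' {j | j ≠ i})) :
    p x ∈ Submodule.span ℚ (R.α '' {j | j ≠ i}) := by
  obtain ⟨l, hl, rfl⟩ := hR.exists_word_of_mem_closure hp
  clear hp
  induction l with
  | nil => exact hx
  | cons j l ih =>
    rw [List.forall_mem_cons] at hl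
    rw [wordProd_cons, LinearEquiv.mul_apply, S, hR.s_apply (hR.simple_mem j)]
    exact Submodule.sub_mem _ (ih hl.2)
      (Submodule.smul_mem _ _ (Submodule.subset_span ⟨j, hl.1, rfl⟩))

lemma exists_comb_of_mem_parPos (hR : R.IsRootSystem) {i : Fin R.r} {β : R.V}
    (hβ : β ∈ R.parPos i) :
    ∃ c : Fin R.r → ℚ, (∀ j, 0 ≤ c j) ∧ c i = 0 ∧ β = ∑ j, c j • R.α j := by
  obtain ⟨c, hc, hβc⟩ := hR.pos_nonneg_comb β hβ.1
  refine ⟨c, hc, ?_, hβc⟩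
  by_contra hci
  refine hR.indep.notMem_span_image (s := {j | j ≠ i}) (x := i) (by simp) ?_
  have hsplit : c i • R.α i = β - ∑ j ∈ Finset.univ.erase i, c j • R.α j := by
    rw [hβc, ← Finset.add_sum_erase _ _ (Finset.mem_univ i)]
    abel
  rw [← Submodule.smul_mem_iff _ hci, hsplit]
  refine Submodule.sub_mem _ hβ.2 (Submodule.sum_mem _ fun j hj => Submodule.smul_mem _ _ ?_)
  exact Submodule.subset_span ⟨j, Finset.ne_of_mem_erase hj, rfl⟩

/-- A root which is a nonnegative combination of positive roots is positive. -/
lemma mem_pos_of_eq_sum (hR : R.IsRootSystem) {γ : R.V} (hγ : γ ∈ R.Φ) {c : Fin R.r → ℚ}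
    (hc : ∀ j, 0 ≤ c j) {f : Fin R.r → R.V} (hf : ∀ j, c j ≠ 0 → f j ∈ R.pos)
    (h : γ = ∑ j, c j • f j) : γ ∈ R.pos := by
  by_contra hneg
  rw [← hR.neg_mem_pos hγ] at hneg
  have hcoord : ∀ j, ∃ d : Fin R.r → ℚ, (∀ k, 0 ≤ d k) ∧ c j • f j = ∑ k, d k • R.α k := by
    intro j
    by_cases hj : c j = 0
    · exact ⟨0, by simp, by simp [hj]⟩
    · obtain ⟨d, hd, hfd⟩ := hR.pos_nonneg_comb _ (hf j hj)
      exact ⟨fun k => c j * d k, fun k => mul_nonneg (hc j) (hd k), by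
        rw [hfd, Finset.smul_sum]; simp [smul_smul]⟩
  choose d hd hcd using hcoord
  obtain ⟨e, he, hγe⟩ := hR.pos_nonneg_comb _ hneg
  have hsum : ∑ k, (∑ j, d j k + e k) • R.α k = 0 := by
    simp only [add_smul, Finset.sum_add_distrib, Finset.sum_smul]
    rw [← hγe, Finset.sum_comm, h]
    simp [hcd]
  have hz := Fintype.linearIndependent_iff.1 hR.indep _ hsum
  have he0 : ∀ k, e k = 0 := fun k => by
    have := hz k
    have h1 : 0 ≤ ∑ j, d j k := Finset.sum_nonneg fun j _ => hd j k
    linarith [he k]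
  refine hR.ne_zero γ hγ (neg_eq_zero.1 ?_)
  rw [hγe]
  simp [he0]

lemma len_mul_of_apply_mem_pos (hR : R.IsRootSystem) {i : Fin R.r} {u : R.Aut}
    (hu : u ∈ R.weylGroup) (hpos : ∀ j ≠ i, u (R.α j) ∈ R.pos) {p : R.Aut}
    (hp : p ∈ R.WPar i) : R.len (u * p) = R.len u + R.len p := by
  have hpar : ∀ β ∈ R.parPos i, u β ∈ R.pos := by
    intro β hβ
    obtain ⟨c, hc, hci, hβc⟩ := hR.exists_comb_of_mem_parPos hβ
    refine hR.mem_pos_of_eq_sum (hR.apply_mem_roots hu (hR.pos_subset hβ.1)) hc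
      (f := fun j => u (R.α j)) (fun j hj => hpos j ?_) (by rw [hβc]; simp)
    rintro rfl
    exact hj hci
  obtain ⟨l, hl, rfl⟩ := hR.exists_word_of_mem_closure hp
  clear hp
  induction l using List.reverseRecOn with
  | nil => simp [wordProd_nil, len_one]
  | append_singleton l j ih =>
    have hj : j ≠ i := hl j (by simp)
    have hl' : ∀ k ∈ l, k ≠ i := fun k hk => hl k (by simp [hk])
    specialize ih hl'
    have hprod : R.wordProd (l ++ [j]) = R.wordProd l * R.S j := by simp [wordProd]
    have hΦ := hR.apply_mem_roots (wordProd_mem l) (hR.simple_mem j)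
    have hspan := hR.apply_mem_span (wordProd_mem_WPar hl')
      (Submodule.subset_span ⟨j, hj, rfl⟩ : R.α j ∈ Submodule.span ℚ (R.α '' {k | k ≠ i}))
    have huW := mul_mem hu (wordProd_mem l)
    rw [hprod, ← mul_assoc]
    by_cases h : R.wordProd l (R.α j) ∈ R.pos
    · rw [hR.len_mul_S_of_mem (wordProd_mem l) h,
        hR.len_mul_S_of_mem huW (hpar _ ⟨h, hspan⟩), ih]
      rfl
    · have h' : (u * R.wordProd l) (R.α j) ∉ R.pos := by
        have hneg := hpar _ ⟨(hR.neg_mem_pos hΦ).2 h, Submodule.neg_mem _ hspan⟩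
        rwa [map_neg, hR.neg_mem_pos (hR.apply_mem_roots hu hΦ)] at hneg
      have h1 := hR.len_mul_S_of_notMem (wordProd_mem l) h
      have h2 := hR.len_mul_S_of_notMem huW h'
      omega

lemma mem_minReps_iff (hR : R.IsRootSystem) {i : Fin R.r} {u : R.Aut} :
    u ∈ R.minReps i ↔ u ∈ R.weylGroup ∧ ∀ j ≠ i, u (R.α j) ∈ R.pos := by
  constructor
  · rintro ⟨hu, hmin⟩
    refine ⟨hu, fun j hj => ?_⟩
    by_contra h
    have h1 := hR.len_mul_S_of_notMem hu h
    have h2 := hmin _ (S_mem_WPar hj)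
    omega
  · rintro ⟨hu, hpos⟩
    refine ⟨hu, fun p hp => ?_⟩
    rw [hR.len_mul_of_apply_mem_pos hu hpos hp]
    omega

lemma len_mul_of_mem_minReps (hR : R.IsRootSystem) {i : Fin R.r} {u p : R.Aut}
    (hu : u ∈ R.minReps i) (hp : p ∈ R.WPar i) : R.len (u * p) = R.len u + R.len p :=
  hR.len_mul_of_apply_mem_pos hu.1 (hR.mem_minReps_iff.1 hu).2 hp

lemma minReps_unique (hR : R.IsRootSystem) {i : Fin R.r} {u u' p p' : R.Aut}
    (hu : u ∈ R.minReps i) (hu' : u' ∈ R.minReps i) (hp : p ∈ R.WPar i) (hp' : p' ∈ R.WPar i)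
    (h : u * p = u' * p') : u = u' := by
  have hq : p' * p⁻¹ ∈ R.WPar i := mul_mem hp' (inv_mem hp)
  have huu' : u = u' * (p' * p⁻¹) := by rw [← mul_assoc, ← h, mul_inv_cancel_right]
  have h1 := hR.len_mul_of_mem_minReps hu' hq
  have h2 := hR.len_mul_of_mem_minReps hu (inv_mem hq)
  have h3 : u * (p' * p⁻¹)⁻¹ = u' := by rw [huu', mul_inv_cancel_right]
  rw [h3] at h2
  rw [← huu'] at h1
  have := hR.eq_one_of_len_eq_zero (WPar_le i hq) (by omega)
  rw [huu', this, mul_one]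

lemma S_mul_eq_mul_S_of_notMem_minReps (hR : R.IsRootSystem) {i k : Fin R.r} {u : R.Aut}
    (hu : u ∈ R.minReps i) (h : R.S k * u ∉ R.minReps i) :
    ∃ j ≠ i, R.S k * u = u * R.S j := by
  have hpos := (hR.mem_minReps_iff.1 hu).2
  rw [hR.mem_minReps_iff] at h
  push Not at h
  obtain ⟨j, hj, hneg⟩ := h (mul_mem (S_mem k) hu.1)
  obtain ⟨c, hc⟩ := (hR.S_apply_mem_pos_or k (hpos j hj)).resolve_left hneg
  refine ⟨j, hj, ?_⟩
  rw [S, hR.s_eq_conj hu.1 (hR.simple_mem j) (hR.simple_mem k) hc, inv_mul_cancel_right, S]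

/-! ### Demazure products -/

lemma dmulList_mem {v : R.Aut} (hv : v ∈ R.weylGroup) (l : List (Fin R.r)) :
    R.dmulList l v ∈ R.weylGroup := by
  induction l with
  | nil => exact hv
  | cons i l ih =>
    change R.dmulStep i (R.dmulList l v) ∈ _
    rw [dmulStep]
    split_ifs
    · exact mul_mem (S_mem i) ih
    · exact ih

lemma exists_dmul_eq_dmulList (hR : R.IsRootSystem) {x : R.Aut} (hx : x ∈ R.weylGroup)
    (v : R.Aut) :
    ∃ l : List (Fin R.r), R.Reduced l ∧ R.wordProd l = x ∧ R.dmul x v = R.dmulList l v := by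
  have h := hR.exists_reduced_word hx
  exact ⟨h.choose, h.choose_spec.1, h.choose_spec.2, by rw [dmul, dif_pos h]⟩

lemma chainLE_dmulList_of_sublist (hR : R.IsRootSystem) {v : R.Aut} (hv : v ∈ R.weylGroup)
    {l m : List (Fin R.r)} (hm : m.Sublist l) :
    R.ChainLE (R.wordProd m * v) (R.dmulList l v) := by
  induction hm with
  | slnil => rw [wordProd_nil, one_mul]; exact .refl
  | @cons _ l i _ ih =>
    change R.ChainLE _ (R.dmulStep i (R.dmulList l v))
    rw [dmulStep]
    split_ifs with h
    · exact ih.trans (hR.chainLE_S_mul (dmulList_mem hv l) h)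
    · exact ih
  | @cons_cons _ l i _ ih =>
    change R.ChainLE _ (R.dmulStep i (R.dmulList l v))
    rw [dmulStep, wordProd_cons, mul_assoc]
    split_ifs with h
    · exact hR.chainLE_S_mul_S_mul (dmulList_mem hv l) ih h
    · exact hR.chainLE_S_mul_left (dmulList_mem hv l) ih h

lemma exists_dmulList_eq_mul (hR : R.IsRootSystem) {i : Fin R.r} {v : R.Aut}
    (hv : v ∈ R.minReps i) (l : List (Fin R.r)) :
    ∃ u ∈ R.minReps i, ∃ p ∈ R.WPar i, R.dmulList l v = u * p ∧
      ∀ h, R.ChainLE h p → ∃ m : List (Fin R.r), m.Sublist l ∧ u * h = R.wordProd m * v := by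
  induction l with
  | nil =>
    refine ⟨v, hv, 1, one_mem _, (mul_one v).symm, fun h hh => ⟨[], .refl _, ?_⟩⟩
    obtain ⟨m, hm, rfl⟩ := hR.exists_sublist_of_chainLE hh [] rfl
    rw [List.sublist_nil.1 hm, wordProd_nil, mul_one, one_mul]
  | cons k l ih =>
    obtain ⟨u, hu, p, hp, hup, hsub⟩ := ih
    have hcons : R.dmulList (k :: l) v = R.dmulStep k (u * p) := by rw [← hup]; rfl
    rw [hcons, dmulStep]
    split_ifs with hlt
    · by_cases hk : R.S k * u ∈ R.minReps i
      · refine ⟨R.S k * u, hk, p, hp, (mul_assoc _ _ _).symm, fun h hh => ?_⟩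
        obtain ⟨m, hm, hmu⟩ := hsub h hh
        exact ⟨k :: m, hm.cons_cons k, by rw [wordProd_cons, mul_assoc, hmu, mul_assoc]⟩
      · obtain ⟨j, hj, hkj⟩ := hR.S_mul_eq_mul_S_of_notMem_minReps hu hk
        have hp' : R.S j * p ∈ R.WPar i := mul_mem (S_mem_WPar hj) hp
        have heq : R.S k * (u * p) = u * (R.S j * p) := by
          rw [← mul_assoc, hkj, mul_assoc]
        refine ⟨u, hu, R.S j * p, hp', heq, fun h hh => ?_⟩
        rw [heq, hR.len_mul_of_mem_minReps hu hp, hR.len_mul_of_mem_minReps hu hp'] at hlt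
        rcases hR.chainLE_or_of_chainLE_S_mul (WPar_le i hp) (by omega) hh with h' | h'
        · obtain ⟨m, hm, hmu⟩ := hsub h h'
          exact ⟨m, hm.cons k, hmu⟩
        · obtain ⟨m, hm, hmu⟩ := hsub _ h'
          refine ⟨k :: m, hm.cons_cons k, ?_⟩
          rw [wordProd_cons, mul_assoc, ← hmu, ← mul_assoc, hkj, mul_assoc, hR.S_mul_S_mul]
    · refine ⟨u, hu, p, hp, rfl, fun h hh => ?_⟩
      obtain ⟨m, hm, hmu⟩ := hsub h hh
      exact ⟨m, hm.cons k, hmu⟩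

end IsRootSystem

end RootData

theorem statement14 (R : RootData) (hR : R.IsRootSystem)
    (w : R.Aut) (hw : w ∈ R.weylGroup)
    (i : Fin R.r) (v : R.Aut) (hv : v ∈ R.minReps i)
    (u : R.Aut) (hu : R.IsMinRep i u (R.dmul w⁻¹ v))
    (y : R.Aut) (hy : y ∈ R.WPar i) (hy1 : R.dmul w⁻¹ v = u * y⁻¹)
    (hy2 : R.len (u * y⁻¹) = R.len u + R.len y) :
    {g : R.Aut | g ∈ R.WPar i ∧ ∃ q : R.Aut, R.BruhatLE q w ∧ g = v⁻¹ * q * u} =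
      {g : R.Aut | R.BruhatLE g y} := by
  obtain ⟨l, hl, hlw, hdm⟩ := hR.exists_dmul_eq_dmulList (inv_mem hw) v
  have hyW := RootData.IsRootSystem.WPar_le i hy
  ext g
  simp only [Set.mem_ofPred_eq, hR.bruhatLE_iff_chainLE hw, hR.bruhatLE_iff_chainLE hyW]
  constructor
  · rintro ⟨hg, q, hq, hgq⟩
    obtain ⟨m, hm, hmq⟩ := hR.exists_sublist_of_chainLE (hR.chainLE_inv hq) l hlw
    have hle := hR.chainLE_dmulList_of_sublist hv.1 hm
    have hug : R.wordProd m * v = u * g⁻¹ := by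
      rw [hmq, hgq]
      group
    rw [hug, ← hdm, hy1] at hle
    have hinv := hR.chainLE_of_chainLE_mul hu.1.1
      (inv_mem (RootData.IsRootSystem.WPar_le i hg)) (inv_mem hyW)
      (hR.len_mul_of_mem_minReps hu.1 (inv_mem hg))
      (hR.len_mul_of_mem_minReps hu.1 (inv_mem hy)) hle
    simpa using hR.chainLE_inv hinv
  · intro hgy
    refine ⟨hR.mem_WPar_of_chainLE hy hgy, ?_⟩
    obtain ⟨u', hu', p, hp, hup, hsub⟩ := hR.exists_dmulList_eq_mul hv l
    have heq : u * y⁻¹ = u' * p := by rw [← hy1, hdm, hup]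
    obtain rfl := hR.minReps_unique hu.1 hu' (inv_mem hy) hp heq
    obtain rfl := mul_left_cancel heq
    obtain ⟨m, hm, hmg⟩ := hsub _ (hR.chainLE_inv hgy)
    refine ⟨(R.wordProd m)⁻¹, ?_, ?_⟩
    · have := hR.chainLE_inv (hR.chainLE_of_sublist hl hm)
      rwa [hlw, inv_inv] at this
    · rw [eq_mul_inv_of_mul_eq hmg.symm]
      group
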